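/- Let n ≥ 1 and let A be an n×n complex matrix that is symmetric (A = Aᵀ). Suppose A admits a decomposition A = L·U where L is a lower triangular matrix with all diagonal entries equal to 1 and U is an upper triangular matrix all of whose diagonal entries u_{ii} are nonzero. Then A can be decomposed as A = Gᵀ·G, where G is an upper triangular n×n complex matrix whose diagonal entries satisfy (G_{ii})² = u_{ii} for every i; explicitly, one may take G = D·U with D the diagonal matrix whose i-th diagonal entry is 1/√(u_{ii}) for some fixed choice of complex square root √(u_{ii}) of u_{ii}. -/

import Mathlib

open Matrix

/-- In a symmetric product `L * U` with `L` unit lower triangular and `U` upper triangular,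
the rows of `U` are the columns of `L` scaled by the pivots. -/
theorem mul_pivot_eq_of_isSymm_mul {ι R : Type*} [Fintype ι] [LinearOrder ι] [CommRing R]
    {L U : Matrix ι ι R} (hsymm : (L * U).IsSymm)
    (hLlow : ∀ i j, i < j → L i j = 0) (hLdiag : ∀ i, L i i = 1)
    (hUup : ∀ i j, j < i → U i j = 0) (k i : ι) :
    L i k * U k k = U k i := by
  induction k using WellFoundedLT.induction generalizing i with
  | ind k ih =>
    have h : ∑ m, L i m * U m k = ∑ m, L k m * U m i := by
      simpa only [mul_apply] using hsymm.apply k i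
    rw [← Finset.add_sum_erase _ _ (Finset.mem_univ k),
      ← Finset.add_sum_erase _ (fun m => L k m * U m i) (Finset.mem_univ k)] at h
    have hrest : ∑ m ∈ Finset.univ.erase k, L i m * U m k =
        ∑ m ∈ Finset.univ.erase k, L k m * U m i := by
      refine Finset.sum_congr rfl fun m hm => ?_
      rcases lt_or_gt_of_ne (Finset.ne_of_mem_erase hm) with hmk | hkm
      · rw [← ih m hmk k, ← ih m hmk i]
        ring
      · rw [hUup m k hkm, hLlow k m hkm, mul_zero, zero_mul]
    rw [hrest] at h
    simpa [hLdiag] using add_right_cancel h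

/-- If an n×n complex symmetric matrix `A` admits a decomposition
`A = L * U` with `L` unit lower triangular and `U` upper triangular with nonzero
diagonal entries, then `A = Gᵀ * G` for an upper triangular `G` with
`(G i i)^2 = U i i`; explicitly `G = D * U` with `D = diagonal (1/√(u_ii))`. -/
theorem cholesky_from_LU (n : ℕ) (hn : 1 ≤ n)
    (A L U : Matrix (Fin n) (Fin n) ℂ)
    (hA : A = Aᵀ)
    (hLlow : ∀ i j : Fin n, i < j → L i j = 0)
    (hLdiag : ∀ i : Fin n, L i i = 1)
    (hUup : ∀ i j : Fin n, j < i → U i j = 0)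
    (hUdiag : ∀ i : Fin n, U i i ≠ 0)
    (hLU : A = L * U) :
    ∃ (G : Matrix (Fin n) (Fin n) ℂ) (d : Fin n → ℂ),
      (∀ i : Fin n, d i ^ 2 = U i i) ∧
      G = Matrix.diagonal (fun i => (d i)⁻¹) * U ∧
      (∀ i j : Fin n, j < i → G i j = 0) ∧
      (∀ i : Fin n, G i i ^ 2 = U i i) ∧
      A = Gᵀ * G := by
  have hL : ∀ k i, L i k * U k k = U k i :=
    mul_pivot_eq_of_isSymm_mul (hLU ▸ hA.symm) hLlow hLdiag hUup
  choose d hd using fun i => IsAlgClosed.exists_pow_nat_eq (U i i) two_pos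
  have hd0 : ∀ i, d i ≠ 0 := fun i h => hUdiag i (by rw [← hd i, h]; ring)
  refine ⟨_, d, hd, rfl, fun i j hij => ?_, fun i => ?_, ?_⟩
  · rw [diagonal_mul, hUup i j hij, mul_zero]
  · have := hd0 i
    rw [diagonal_mul, ← hd i]
    field_simp
  · ext i j
    rw [hLU, mul_apply, mul_apply]
    refine Finset.sum_congr rfl fun k _ => ?_
    have := hd0 k
    rw [transpose_apply, diagonal_mul, diagonal_mul, ← hL k i, ← hd k]
    field_simp
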